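/- Let c_1, …, c_n ≥ 0 and C ≥ 0. Let D be a pseudo-distribution on {0,1}^n of degree at least 2t satisfying the constraint ∑_{i=1}^n c_i x_i ≤ C, and let S ⊆ [n] be such that Ẽ_D[X_T] = 0 for all T ⊆ S with t ≤ |T| ≤ 2t and Ẽ_D[X_T · x_i] = 0 for all T ⊆ S with |T| ≥ t and i ∈ [n]. Fix U ⊆ S with Ẽ_D[rd(f_{S,U})] > 0 and define y_i^U = Ẽ_D[x_i · rd(f_{S,U})] / Ẽ_D[rd(f_{S,U})]. Then ∑_{i ∉ S} c_i y_i^U ≤ C − ∑_{i ∈ U} c_i. -/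

import Mathlib

/-- The point of `{0,1}` encoded by a boolean. -/
def b01 (b : Bool) : ℝ := if b then 1 else 0

/-- Pseudo-expectation of `f` with respect to `D` on `{0,1}^n`. -/
def PE {n : ℕ} (D f : (Fin n → Bool) → ℝ) : ℝ := ∑ x, D x * f x

/-- The monomial `X_T(x) = ∏_{i ∈ T} x_i` on `{0,1}^n`. -/
def XS {n : ℕ} (T : Finset (Fin n)) (x : Fin n → Bool) : ℝ := ∏ i ∈ T, b01 (x i)

/-- `f : {0,1}^n → ℝ` is a (multilinear) polynomial of degree at most `d`. -/
def DegLE {n : ℕ} (d : ℕ) (f : (Fin n → Bool) → ℝ) : Prop :=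
  ∃ c : Finset (Fin n) → ℝ, (∀ T : Finset (Fin n), d < T.card → c T = 0) ∧
    ∀ x, f x = ∑ T : Finset (Fin n), c T * XS T x

/-- `f_{S,U}` viewed as a function on `{0,1}^n`: the indicator that the set of
1-coordinates of `x` inside `S` is exactly `U`. -/
def indF {n : ℕ} (S U : Finset (Fin n)) (x : Fin n → Bool) : ℝ :=
  if S.filter (fun i => x i = true) = U then 1 else 0

/-- `rd`: the truncation of the multilinear polynomial with coefficients `c`
to monomials of degree strictly less than `t`. -/
def rd {n : ℕ} (t : ℕ) (c : Finset (Fin n) → ℝ) (x : Fin n → Bool) : ℝ :=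
  ∑ T ∈ Finset.univ.filter (fun T : Finset (Fin n) => T.card < t), c T * XS T x

lemma XS_eq_ite {n : ℕ} (T : Finset (Fin n)) (x : Fin n → Bool) :
    XS T x = if ∀ i ∈ T, x i = true then 1 else 0 := by
  simp [XS, b01, Finset.prod_ite_zero]

lemma XS_mul_XS {n : ℕ} (T T' : Finset (Fin n)) (x : Fin n → Bool) :
    XS T x * XS T' x = XS (T ∪ T') x := by
  simp only [XS_eq_ite, Finset.mem_union, or_imp, forall_and, ite_and]
  split_ifs <;> simp

lemma PE_sum {n : ℕ} {ι : Type*} (s : Finset ι) (D : (Fin n → Bool) → ℝ)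
    (f : ι → (Fin n → Bool) → ℝ) :
    PE D (fun x => ∑ j ∈ s, f j x) = ∑ j ∈ s, PE D (f j) := by
  simp only [PE, Finset.mul_sum]
  exact Finset.sum_comm

lemma PE_const_mul {n : ℕ} (D : (Fin n → Bool) → ℝ) (a : ℝ) (f : (Fin n → Bool) → ℝ) :
    PE D (fun x => a * f x) = a * PE D f := by
  simp only [PE, Finset.mul_sum]
  exact Finset.sum_congr rfl fun x _ => by ring

lemma PE_sub {n : ℕ} (D f g : (Fin n → Bool) → ℝ) :
    PE D (fun x => f x - g x) = PE D f - PE D g := by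
  simp only [PE, mul_sub, Finset.sum_sub_distrib]

/-- A multilinear expansion of a junta on `S` involves only monomials supported in `S`. -/
lemma coeff_eq_zero_of_junta {n : ℕ} (S : Finset (Fin n)) (F : (Fin n → Bool) → ℝ)
    (hF : ∀ x y, (∀ i ∈ S, x i = y i) → F x = F y) (a : Finset (Fin n) → ℝ)
    (ha : ∀ x, F x = ∑ T : Finset (Fin n), a T * XS T x)
    (T : Finset (Fin n)) (hT : ¬ T ⊆ S) : a T = 0 := by
  have key : ∀ R : Finset (Fin n), F (fun i => decide (i ∈ R)) = ∑ T ∈ R.powerset, a T := by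
    intro R
    rw [ha]
    simp only [XS_eq_ite, decide_eq_true_eq, mul_ite, mul_one, mul_zero]
    rw [← Finset.sum_filter]
    refine Finset.sum_congr ?_ fun _ _ => rfl
    ext T'
    simp [Finset.subset_iff]
  induction T using Finset.strongInduction with
  | H T ih =>
    have h : F (fun i => decide (i ∈ T)) = F (fun i => decide (i ∈ T ∩ S)) :=
      hF _ _ fun i hi => by simp [hi]
    rw [key, key] at h
    have hsub : insert T (T ∩ S).powerset ⊆ T.powerset := by
      intro R hR
      rcases Finset.mem_insert.1 hR with rfl | hR
      · simp
      · exact Finset.mem_powerset.2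
          ((Finset.mem_powerset.1 hR).trans Finset.inter_subset_left)
    rw [← Finset.sum_subset hsub, Finset.sum_insert] at h
    · linarith
    · exact fun hmem => hT ((Finset.mem_powerset.1 hmem).trans Finset.inter_subset_right)
    · intro R hR hR'
      simp only [Finset.mem_insert, Finset.mem_powerset, not_or] at hR hR'
      exact ih R (Finset.ssubset_iff_subset_ne.2 ⟨hR, hR'.1⟩)
        fun hRS => hR'.2 (Finset.subset_inter hR hRS)

lemma indF_mul_self {n : ℕ} (S U : Finset (Fin n)) (x : Fin n → Bool) :
    indF S U x * indF S U x = indF S U x := by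
  unfold indF
  split_ifs <;> simp

lemma b01_mul_indF {n : ℕ} {S U : Finset (Fin n)} {i : Fin n} (hi : i ∈ S)
    (x : Fin n → Bool) :
    b01 (x i) * indF S U x = if i ∈ U then indF S U x else 0 := by
  unfold indF
  by_cases h : S.filter (fun i => x i = true) = U
  · subst h
    simp [hi, b01]
  · simp [h]

/-- The part of the expansion that `rd` discards. -/
def rdTail {n : ℕ} (t : ℕ) (c : Finset (Fin n) → ℝ) (x : Fin n → Bool) : ℝ :=
  ∑ T ∈ Finset.univ.filter (fun T : Finset (Fin n) => ¬ T.card < t), c T * XS T x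

lemma rd_add_rdTail {n : ℕ} (t : ℕ) (c : Finset (Fin n) → ℝ) (x : Fin n → Bool) :
    rd t c x + rdTail t c x = ∑ T : Finset (Fin n), c T * XS T x :=
  Finset.sum_filter_add_sum_filter_not _ _ _

lemma degLE_rd {n t : ℕ} (ht : 0 < t) (c : Finset (Fin n) → ℝ) : DegLE (t - 1) (rd t c) := by
  refine ⟨fun T => if T.card < t then c T else 0, fun T hT => if_neg (by omega), fun x => ?_⟩
  simp only [rd, Finset.sum_filter, ite_mul, zero_mul]

/-- If `w` annihilates all monomials of degree at least `t` supported in `S`, it annihilates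
every multiple of the discarded tail by a polynomial supported in `S`. -/
lemma PE_mul_mul_rdTail {n t : ℕ} (D w : (Fin n → Bool) → ℝ) (S : Finset (Fin n))
    (hw : ∀ T ⊆ S, t ≤ T.card → PE D (fun x => w x * XS T x) = 0)
    (a : Finset (Fin n) → ℝ) (ha : ∀ T, ¬ T ⊆ S → a T = 0)
    (s : Finset (Finset (Fin n)))
    (c : Finset (Fin n) → ℝ) (hc : ∀ T, ¬ T ⊆ S → c T = 0) :
    PE D (fun x => w x * ((∑ R ∈ s, a R * XS R x) * rdTail t c x)) = 0 := by
  have h : (fun x => w x * ((∑ R ∈ s, a R * XS R x) * rdTail t c x)) =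
      fun x => ∑ R ∈ s, ∑ T ∈ Finset.univ.filter (fun T : Finset (Fin n) => ¬ T.card < t),
        a R * c T * (w x * XS (R ∪ T) x) := by
    funext x
    rw [rdTail, Finset.sum_mul_sum, Finset.mul_sum]
    refine Finset.sum_congr rfl fun R _ => ?_
    rw [Finset.mul_sum]
    refine Finset.sum_congr rfl fun T _ => ?_
    rw [← XS_mul_XS]
    ring
  rw [h, PE_sum]
  refine Finset.sum_eq_zero fun R _ => ?_
  rw [PE_sum]
  refine Finset.sum_eq_zero fun T hT => ?_
  rw [PE_const_mul]
  by_cases hR : R ⊆ S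
  · by_cases hTS : T ⊆ S
    · rw [hw _ (Finset.union_subset hR hTS), mul_zero]
      exact (not_lt.1 (Finset.mem_filter.1 hT).2).trans
        (Finset.card_le_card Finset.subset_union_right)
    · simp [hc T hTS]
  · simp [ha R hR]

/-- the conditioned fractional solution `y_i^U` satisfies the
residual capacity constraint: `∑_{i ∉ S} c_i y_i^U ≤ C − ∑_{i ∈ U} c_i`. -/
theorem conditional_expectation_capacity (n t : ℕ) (c : Fin n → ℝ)
    (hc : ∀ i, 0 ≤ c i) (C : ℝ) (hC : 0 ≤ C)
    (D : (Fin n → Bool) → ℝ) (hsum : ∑ x, D x = 1)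
    (hdeg : ∀ f : (Fin n → Bool) → ℝ, DegLE t f → 0 ≤ PE D (fun x => f x * f x))
    (hcon : ∀ f : (Fin n → Bool) → ℝ, DegLE (t - 1) f →
      0 ≤ PE D (fun x => (C - ∑ i, c i * b01 (x i)) * (f x * f x)))
    (S : Finset (Fin n))
    (hXT : ∀ T : Finset (Fin n), T ⊆ S → t ≤ T.card → T.card ≤ 2 * t →
      PE D (XS T) = 0)
    (hXTi : ∀ T : Finset (Fin n), T ⊆ S → t ≤ T.card → ∀ i : Fin n,
      PE D (fun x => XS T x * b01 (x i)) = 0)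
    (coeff : Finset (Fin n) → Finset (Fin n) → ℝ)
    (hcoeff : ∀ (U : Finset (Fin n)) (x : Fin n → Bool),
      indF S U x = ∑ T : Finset (Fin n), coeff U T * XS T x)
    (U : Finset (Fin n)) (hU : U ⊆ S)
    (hpos : 0 < PE D (rd t (coeff U))) :
    ∑ i ∈ Sᶜ, c i *
        (PE D (fun x => b01 (x i) * rd t (coeff U) x) / PE D (rd t (coeff U)))
      ≤ C - ∑ i ∈ U, c i := by
  have ht : 0 < t := by
    rcases Nat.eq_zero_or_pos t with rfl | h
    · simp [PE, rd] at hpos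
    · exact h
  have ha : ∀ T, ¬ T ⊆ S → coeff U T = 0 := by
    refine coeff_eq_zero_of_junta S (indF S U) (fun x y hxy => ?_) _ (hcoeff U)
    unfold indF
    rw [Finset.filter_congr fun i hi => by rw [hxy i hi]]
  have hi0 : ∀ i, ∀ T ⊆ S, t ≤ T.card → PE D (fun x => b01 (x i) * XS T x) = 0 := by
    intro i T hT hcard
    simpa only [mul_comm] using hXTi T hT hcard i
  have h1 : ∀ T ⊆ S, t ≤ T.card → PE D (fun x => 1 * XS T x) = 0 := by
    intro T hT hcard
    obtain ⟨i, hi⟩ := Finset.card_pos.1 (ht.trans_le hcard)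
    rw [← hXTi T hT hcard i]
    congr 1
    funext x
    have : XS {i} x = b01 (x i) := Finset.prod_singleton _ _
    rw [← this, XS_mul_XS, Finset.union_eq_left.2 (Finset.singleton_subset_iff.2 hi), one_mul]
  have hw : ∀ T ⊆ S, t ≤ T.card →
      PE D (fun x => (C - ∑ i, c i * b01 (x i)) * XS T x) = 0 := by
    intro T hT hcard
    have h : (fun x => (C - ∑ i, c i * b01 (x i)) * XS T x) =
        fun x => C * (1 * XS T x) - ∑ i, c i * (b01 (x i) * XS T x) := by
      funext x
      simp only [sub_mul, Finset.sum_mul, mul_assoc, one_mul]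
    rw [h, PE_sub, PE_const_mul, PE_sum, h1 T hT hcard]
    simp [PE_const_mul, hi0 _ T hT hcard]
  have hrd : ∀ x, rd t (coeff U) x = indF S U x - rdTail t (coeff U) x := fun x => by
    rw [hcoeff, ← rd_add_rdTail t]
    ring
  have hlin : ∀ w : (Fin n → Bool) → ℝ,
      (∀ T ⊆ S, t ≤ T.card → PE D (fun x => w x * XS T x) = 0) →
      PE D (fun x => w x * rd t (coeff U) x) = PE D (fun x => w x * indF S U x) := by
    intro w hw
    have h := PE_mul_mul_rdTail D w S hw (fun T => if T = ∅ then 1 else 0)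
      (fun T hT => if_neg fun h : T = ∅ => hT (h ▸ Finset.empty_subset S)) {∅} (coeff U) ha
    simp only [Finset.sum_singleton, if_true, XS, Finset.prod_empty, one_mul] at h
    simp only [hrd, mul_sub]
    rw [PE_sub, h, sub_zero]
  have hL : PE D (rd t (coeff U)) = PE D (indF S U) := by
    simpa only [one_mul] using hlin (fun _ => 1) h1
  have hsq : PE D (fun x => (C - ∑ i, c i * b01 (x i)) *
      (rd t (coeff U) x * rd t (coeff U) x)) =
      PE D (fun x => (C - ∑ i, c i * b01 (x i)) * indF S U x) := by
    have hf := PE_mul_mul_rdTail D _ S hw (coeff U) ha Finset.univ (coeff U) ha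
    have hg := PE_mul_mul_rdTail D _ S hw (coeff U) ha
      (Finset.univ.filter fun T : Finset (Fin n) => T.card < t) (coeff U) ha
    simp only [← hcoeff] at hf
    simp only [← rd.eq_1] at hg
    rw [← sub_zero (PE D fun x => (C - ∑ i, c i * b01 (x i)) * indF S U x), ← hf, ← PE_sub,
      ← sub_zero (PE D fun x => _ - _), ← hg, ← PE_sub]
    congr 1
    funext x
    linear_combination (C - ∑ i, c i * b01 (x i)) *
      ((rd t (coeff U) x + indF S U x) * hrd x + indF_mul_self S U x)
  have hnonneg := hcon _ (degLE_rd ht (coeff U))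
  have hexp : PE D (fun x => (C - ∑ i, c i * b01 (x i)) * indF S U x) =
      C * PE D (indF S U) - ∑ i, c i * PE D (fun x => b01 (x i) * indF S U x) := by
    simp only [sub_mul, Finset.sum_mul, mul_assoc]
    rw [PE_sub, PE_const_mul, PE_sum]
    simp only [PE_const_mul]
  have hS : ∑ i ∈ S, c i * PE D (fun x => b01 (x i) * indF S U x) =
      (∑ i ∈ U, c i) * PE D (indF S U) := by
    rw [Finset.sum_mul, ← Finset.sum_subset hU]
    · refine Finset.sum_congr rfl fun i hi => ?_
      simp only [b01_mul_indF (hU hi), if_pos hi]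
    · intro i hi hiU
      simp only [b01_mul_indF hi, if_neg hiU, PE, mul_zero, Finset.sum_const_zero]
  rw [hsq, hexp, ← Finset.sum_add_sum_compl S, hS] at hnonneg
  simp only [hlin _ (hi0 _), hL, ← mul_div_assoc]
  rw [hL] at hpos
  rw [← Finset.sum_div, div_le_iff₀ hpos]
  linarith
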